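/- Let p be an odd prime and let s ≥ 1 and i ≥ 0 be integers; set m = s(p−1) and n = (m+i)p − i. If u is any partition with w(u) = n and d(u) ≤ i+1, then v_p(τ_u) ≥ s(p−2) − 1. -/

import Mathlib

open Finsupp MvPolynomial

noncomputable section

/-- weight of a partition (given as the multiplicity function of its parts) -/
def wt (u : ℕ →₀ ℕ) : ℕ := u.sum fun i m => i * m

/-- degree (number of parts) -/
def deg (u : ℕ →₀ ℕ) : ℕ := u.sum fun _ m => m

/-- γ_u = Π_i (i+1)^{u_i} (u_i)! -/
def gam (u : ℕ →₀ ℕ) : ℕ := u.prod fun i m => (i + 1) ^ m * m.factorial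

/-- τ_u = (−1)^{d(u)−1} (w(u)+d(u)−2)! / γ_u -/
def tau (u : ℕ →₀ ℕ) : ℚ :=
  (-1 : ℚ) ^ (deg u - 1) * (Nat.factorial (wt u + deg u - 2) : ℚ) / (gam u : ℚ)

/-- p-adic valuation on ℚ with v_p(0) = ⊤ -/
def pval (p : ℕ) (x : ℚ) : WithTop ℤ :=
  if x = 0 then ⊤ else ((padicValRat p x : ℤ) : WithTop ℤ)

/-- The `p`-adic valuation of a finite product of nonzero naturals is the sum of the valuations. -/
theorem padicValNat_finset_prod {ι : Type*} (p : ℕ) [Fact p.Prime] (S : Finset ι) (f : ι → ℕ)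
    (hf : ∀ j ∈ S, f j ≠ 0) : padicValNat p (∏ j ∈ S, f j) = ∑ j ∈ S, padicValNat p (f j) := by
  classical
  induction S using Finset.induction_on with
  | empty => simp
  | insert a S ha ih =>
    have hS : ∀ j ∈ S, f j ≠ 0 := fun j hj => hf j (Finset.mem_insert_of_mem hj)
    rw [Finset.prod_insert ha, Finset.sum_insert ha,
      padicValNat.mul (hf a (Finset.mem_insert_self a S)) (Finset.prod_ne_zero_iff.mpr hS), ih hS]

theorem padicValNat_mono_of_dvd (p : ℕ) [Fact p.Prime] {a b : ℕ} (hb : b ≠ 0) (h : a ∣ b) :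
    padicValNat p a ≤ padicValNat p b :=
  (padicValNat_dvd_iff_le hb).mp (pow_padicValNat_dvd.trans h)

/-- A positive integer `q` is at least of size linear in its `p`-adic valuation. -/
theorem mul_padicValNat_le (p : ℕ) [hp : Fact p.Prime] (q : ℕ) (hq : q ≠ 0) :
    (p : ℤ) * (p - 1) * padicValNat p q ≤ p * (p - 2) + q := by
  have h2 : (2 : ℤ) ≤ p := by exact_mod_cast hp.out.two_le
  obtain h0 | ⟨a, ha⟩ : padicValNat p q = 0 ∨ ∃ a, padicValNat p q = a + 1 := by
    cases padicValNat p q <;> simp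
  · rw [h0]
    have : (0 : ℤ) ≤ p * (p - 2) := mul_nonneg (by linarith) (by linarith)
    push_cast
    linarith [Int.natCast_nonneg q]
  · have hle : p ^ (a + 1) ≤ q :=
      Nat.le_of_dvd (Nat.pos_of_ne_zero hq) (ha ▸ pow_padicValNat_dvd)
    have hle' : (p : ℤ) ^ (a + 1) ≤ q := by exact_mod_cast hle
    have hb : 1 + (a : ℤ) * (p - 1) ≤ (1 + (p - 1)) ^ a :=
      one_add_mul_le_pow (by linarith) a
    rw [add_sub_cancel] at hb
    have := mul_le_mul_of_nonneg_left hb (by linarith : (0 : ℤ) ≤ p)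
    rw [ha]
    push_cast
    rw [pow_succ] at hle'
    linarith

/-- The valuation of `∏ (j + 1) ^ u_j` in terms of weight and degree. -/
theorem mul_sum_padicValNat_le (p : ℕ) [Fact p.Prime] (u : ℕ →₀ ℕ) :
    (p : ℤ) * (p - 1) * (∑ j ∈ u.support, u j * padicValNat p (j + 1) : ℕ) ≤
      deg u * (p * (p - 2)) + (wt u + deg u) := by
  simp only [wt, deg, Finsupp.sum]
  push_cast
  rw [Finset.mul_sum, Finset.sum_mul, ← Finset.sum_add_distrib, ← Finset.sum_add_distrib]
  refine Finset.sum_le_sum fun j _ => ?_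
  have h := mul_le_mul_of_nonneg_left (mul_padicValNat_le p (j + 1) j.succ_ne_zero)
    (Int.natCast_nonneg (u j))
  push_cast at h
  linarith

theorem gam_ne_zero (u : ℕ →₀ ℕ) : gam u ≠ 0 :=
  Finset.prod_ne_zero_iff.mpr fun j _ =>
    mul_ne_zero (pow_ne_zero _ j.succ_ne_zero) (Nat.factorial_ne_zero _)

theorem padicValNat_gam_le (p : ℕ) [Fact p.Prime] (u : ℕ →₀ ℕ) :
    padicValNat p (gam u) ≤
      (∑ j ∈ u.support, u j * padicValNat p (j + 1)) + padicValNat p (deg u).factorial := by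
  have hdvd : padicValNat p (∏ j ∈ u.support, (u j).factorial) ≤
      padicValNat p (deg u).factorial :=
    padicValNat_mono_of_dvd p (Nat.factorial_ne_zero _)
      (Nat.prod_factorial_dvd_factorial_sum u.support u)
  rw [gam, Finsupp.prod, Finset.prod_mul_distrib,
    padicValNat.mul (Finset.prod_ne_zero_iff.mpr fun j _ => pow_ne_zero _ j.succ_ne_zero)
      (Finset.prod_ne_zero_iff.mpr fun j _ => Nat.factorial_ne_zero _),
    padicValNat_finset_prod p _ _ fun j _ => pow_ne_zero _ j.succ_ne_zero]
  simp only [padicValNat.pow]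
  gcongr

theorem pval_tau (p : ℕ) [Fact p.Prime] (u : ℕ →₀ ℕ) :
    pval p (tau u) = (((padicValNat p (wt u + deg u - 2).factorial : ℤ) -
      padicValNat p (gam u) : ℤ) : WithTop ℤ) := by
  have hA : ((wt u + deg u - 2).factorial : ℚ) ≠ 0 := by exact_mod_cast Nat.factorial_ne_zero _
  have hG : (gam u : ℚ) ≠ 0 := by exact_mod_cast gam_ne_zero u
  have hs : ((-1 : ℚ) ^ (deg u - 1)) ≠ 0 := pow_ne_zero _ (by norm_num)
  have hv : padicValRat p ((-1 : ℚ) ^ (deg u - 1)) = 0 := by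
    rcases neg_one_pow_eq_or ℚ (deg u - 1) with h | h <;> simp [h]
  rw [pval, tau, if_neg (div_ne_zero (mul_ne_zero hs hA) hG),
    padicValRat.div (mul_ne_zero hs hA) hG, padicValRat.mul hs hA, hv, zero_add,
    padicValRat.of_nat, padicValRat.of_nat]

/-- for an odd prime p, m = s(p−1), n = (m+i)p − i, and any
partition u of n with d(u) ≤ i+1, one has v_p(τ_u) ≥ s(p−2) − 1. -/
theorem stmt_2 (p : ℕ) (hp : p.Prime) (hodd : p ≠ 2) (s i : ℕ) (hs : 1 ≤ s)
    (m n : ℕ) (hm : m = s * (p - 1)) (hn : n = (m + i) * p - i)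
    (u : ℕ →₀ ℕ) (hu0 : u 0 = 0) (hw : wt u = n) (hd : deg u ≤ i + 1) :
    (((s : ℤ) * ((p : ℤ) - 2) - 1 : ℤ) : WithTop ℤ) ≤ pval p (tau u) := by
  have : Fact p.Prime := ⟨hp⟩
  have hp3 : 3 ≤ p := by
    have := hp.two_le
    omega
  rw [pval_tau, WithTop.coe_le_coe]
  have hG := padicValNat_gam_le p u
  have hV := mul_sum_padicValNat_le p u
  set V := ∑ j ∈ u.support, u j * padicValNat p (j + 1)
  obtain ⟨e, he⟩ : ∃ e, deg u + e = i + 1 := ⟨i + 1 - deg u, by omega⟩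
  have hip : i ≤ (m + i) * p :=
    (Nat.le_add_left i m).trans (Nat.le_mul_of_pos_right _ (by omega))
  have hwz : (wt u : ℤ) = (m + i) * p - i := by
    rw [hw, hn, Nat.cast_sub hip]
    push_cast
    ring
  have hmz : (m : ℤ) = s * (p - 1) := by
    rw [hm, Nat.cast_mul, Nat.cast_sub (by omega)]
    simp
  have hm2 : 2 ≤ m := by
    rw [hm]
    exact Nat.mul_le_mul hs (by omega : 2 ≤ p - 1)
  have hez : (deg u : ℤ) = i + 1 - e := by
    have : ((deg u + e : ℕ) : ℤ) = (i + 1 : ℕ) := by rw [he]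
    push_cast at this
    linarith
  have hpk : p * (e / p) ≤ e := Nat.mul_div_le e p
  have hke : e < p * (e / p) + p := by
    have := Nat.mod_lt e (by omega : p > 0)
    have := Nat.div_add_mod e p
    omega
  set k := e / p
  have hk2 : 3 * k ≤ e := (Nat.mul_le_mul_right k hp3).trans hpk
  obtain ⟨K, hK⟩ : ∃ K, K + (k + 1) = m + i := ⟨m + i - (k + 1), by omega⟩
  have hKz : (K : ℤ) = m + i - k - 1 := by
    have : ((K + (k + 1) : ℕ) : ℤ) = (m + i : ℕ) := by rw [hK]
    push_cast at this
    linarith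
  have hpz : (3 : ℤ) ≤ p := by exact_mod_cast hp3
  have hpkz : (p : ℤ) * k ≤ e := by exact_mod_cast hpk
  have hkez : (e : ℤ) + 1 ≤ p * k + p := by exact_mod_cast hke
  have hpK : p * K ≤ wt u + deg u - 2 := by
    have : (p : ℤ) * K + 2 ≤ wt u + deg u := by
      rw [hwz, hez, hKz]
      linarith
    have : p * K + 2 ≤ wt u + deg u := by exact_mod_cast this
    omega
  have hdK : deg u ≤ K := by omega
  have h1 : padicValNat p K.factorial + K ≤ padicValNat p (wt u + deg u - 2).factorial := by
    rw [← padicValNat_factorial_mul]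
    exact padicValNat_mono_of_dvd p (Nat.factorial_ne_zero _) (Nat.factorial_dvd_factorial hpK)
  have h2 : padicValNat p (deg u).factorial ≤ padicValNat p K.factorial :=
    padicValNat_mono_of_dvd p (Nat.factorial_ne_zero _) (Nat.factorial_dvd_factorial hdK)
  have hVK : (V : ℤ) ≤ s + i - k := by
    by_contra! hlt
    have hmul := mul_le_mul_of_nonneg_left (Int.add_one_le_iff.mpr hlt)
      (mul_nonneg (by linarith) (by linarith) : (0 : ℤ) ≤ p * (p - 1))
    have hcmp : (p - 1 : ℤ) * (1 + e * (p - 1)) ≤ (p - 1) * (p * k) := by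
      rw [hwz, hez, hmz] at hV
      linarith
    have hcmp' := le_of_mul_le_mul_left hcmp (by linarith)
    nlinarith [Int.natCast_nonneg e]
  have hkey : (s : ℤ) * (p - 2) - 1 ≤ K - V := by
    rw [hKz, hmz]
    linarith
  omega

end
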